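/- (Constrained global solvability) Let P be a topological space, (X,d) a complete and metrically convex metric space, Y a normed vector space, F : P×X ⇉ Y with F(p,x) nonempty closed for every (p,x), C : P ⇉ Y with each C(p) a closed convex cone satisfying {0} ≠ C(p) ⊊ Y, and R : P ⇉ X. Suppose that: (i) for every p ∈ P there exists x̂_p ∈ X with e(F(p,x̂_p), C(p)) < +∞; (ii) α̃_{F,C,R} > 1; (iii) F(p,·) is lower semicontinuous on X for every p ∈ P and Lipschitz continuous on X \ R(p) (in the Hausdorff distance) with a constant ℓ, 0 < ℓ < α̃_{F,C,R} − 1, uniform in p; (iv) R(p) is proximinal for every p ∈ P. Then S_R(p) = {x ∈ R(p) : F(p,x) ⊆ C(p)} is nonempty for every p ∈ P, and for every α with (α̃_{F,C,R} − ℓ + 1)/2 < α < α̃_{F,C,R} − ℓ and every x₀ ∈ X it holds dist(x₀, S_R(p)) ≤ [e(F(p,x₀), C(p)) + (α̃_{F,C,R} − α)·dist(x₀, R(p))] / (α̃_{F,C,R} − α − ℓ) for all p ∈ P. -/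

import Mathlib

open Set Metric EMetric ENNReal Pointwise Filter Topology

/-- Excess of `A` beyond `B`: `e(A,B) = ⨆ a ∈ A, dist(a,B)` in `[0,∞]`. -/
noncomputable def excess {Y : Type*} [PseudoEMetricSpace Y] (A B : Set Y) : ℝ≥0∞ :=
  ⨆ a ∈ A, EMetric.infEdist a B

/-- `C` is a closed convex cone (containing the origin). -/
def IsClosedConvexCone {Y : Type*} [SeminormedAddCommGroup Y] [NormedSpace ℝ Y]
    (C : Set Y) : Prop :=
  IsClosed C ∧ Convex ℝ C ∧ (0 : Y) ∈ C ∧ ∀ c ∈ C, ∀ t : ℝ, 0 ≤ t → t • c ∈ C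

/-- `a` is an admissible bound of metric `C`-increase of `G` at `x₀`. -/
def IsIncBoundAt {X Y : Type*} [PseudoMetricSpace X] [SeminormedAddCommGroup Y]
    (G : X → Set Y) (C : Set Y) (x₀ : X) (a : ℝ) : Prop :=
  1 < a ∧ ∃ δ : ℝ, 0 < δ ∧ ∀ r : ℝ, 0 < r → r ≤ δ →
    ∃ u ∈ Metric.closedBall x₀ r,
      Metric.cthickening (a * r) (G u) ⊆ Metric.cthickening r (G x₀ + C)

/-- `G` is metrically `C`-increasing at `x₀`. -/
def CIncreasingAt {X Y : Type*} [PseudoMetricSpace X] [SeminormedAddCommGroup Y]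
    (G : X → Set Y) (C : Set Y) (x₀ : X) : Prop :=
  ∃ a : ℝ, IsIncBoundAt G C x₀ a

/-- The exact bound of metric `C`-increase of `G` at `x₀` (in `[0,∞]`). -/
noncomputable def incBound {X Y : Type*} [PseudoMetricSpace X] [SeminormedAddCommGroup Y]
    (G : X → Set Y) (C : Set Y) (x₀ : X) : ℝ≥0∞ :=
  ⨆ a ∈ {a : ℝ | IsIncBoundAt G C x₀ a}, ENNReal.ofReal a

/-- Lower semicontinuity of a set-valued mapping. -/
def LscSV {P Y : Type*} [TopologicalSpace P] [TopologicalSpace Y] (G : P → Set Y) : Prop :=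
  ∀ p : P, ∀ A : Set Y, IsOpen A → (G p ∩ A).Nonempty →
    ∀ᶠ p' in nhds p, (G p' ∩ A).Nonempty

/-- Upper semicontinuity of a set-valued mapping. -/
def UscSV {P Y : Type*} [TopologicalSpace P] [TopologicalSpace Y] (G : P → Set Y) : Prop :=
  ∀ p : P, ∀ A : Set Y, IsOpen A → G p ⊆ A → ∀ᶠ p' in nhds p, G p' ⊆ A

/-- Hausdorff `C`-upper semicontinuity at a point. -/
def HausdorffCUscAt {P Y : Type*} [TopologicalSpace P] [SeminormedAddCommGroup Y]
    (G : P → Set Y) (C : Set Y) (p₀ : P) : Prop :=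
  ∀ ε : ℝ, 0 < ε → ∀ᶠ p in nhds p₀, G p ⊆ Metric.cthickening ε (G p₀ + C)

/-- `C`-concavity of a set-valued mapping. -/
def CConcave {X Y : Type*} [SeminormedAddCommGroup X] [NormedSpace ℝ X]
    [SeminormedAddCommGroup Y] [NormedSpace ℝ Y] (G : X → Set Y) (C : Set Y) : Prop :=
  ∀ x₁ x₂ : X, ∀ t : ℝ, t ∈ Set.Icc (0:ℝ) 1 →
    G (t • x₁ + (1 - t) • x₂) ⊆ t • G x₁ + (1 - t) • G x₂ + C

/-- A set is proximinal if the distance to it is attained from every point. -/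
def Proximinal {X : Type*} [PseudoMetricSpace X] (S : Set X) : Prop :=
  ∀ x : X, ∃ s ∈ S, dist x s = Metric.infDist x S

/-- Metric (Menger) convexity of a metric space. -/
def MetricallyConvex (X : Type*) [PseudoMetricSpace X] : Prop :=
  ∀ a b : X, a ≠ b → ∃ c : X, c ≠ a ∧ c ≠ b ∧ dist a b = dist a c + dist c b

/-- The constant `α_{F,C}` associated with a parameterized set-valued inclusion. -/
noncomputable def alphaFC {P X Y : Type*} [PseudoMetricSpace X] [SeminormedAddCommGroup Y]
    (F : P → X → Set Y) (Cm : P → Set Y) : ℝ≥0∞ :=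
  ⨅ q ∈ {q : P × X | ¬ (F q.1 q.2 ⊆ Cm q.1)}, incBound (F q.1) (Cm q.1) q.2

/-- The constant `α̃_{F,C,R}` associated with a constrained set-valued inclusion. -/
noncomputable def alphaTilde {P X Y : Type*} [PseudoMetricSpace X] [SeminormedAddCommGroup Y]
    (F : P → X → Set Y) (Cm : P → Set Y) (R : P → Set X) : ℝ≥0∞ :=
  ⨅ q ∈ {q : P × X | ¬ (F q.1 q.2 ⊆ Cm q.1) ∧ q.2 ∈ R q.1}, incBound (F q.1) (Cm q.1) q.2

/-- The exact bound of `C`-decrease of a single-valued map: `dec(g,C,x₀) = inc(−g,C,x₀)`. -/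
noncomputable def decBound {X Y : Type*} [PseudoMetricSpace X] [SeminormedAddCommGroup Y]
    (g : X → Y) (C : Set Y) (x₀ : X) : ℝ≥0∞ :=
  incBound (fun x => ({-g x} : Set Y)) C x₀

/-- `g` is `C`-decreasing at `x₀` iff `−g` is `C`-increasing there. -/
def CDecreasingAt {X Y : Type*} [PseudoMetricSpace X] [SeminormedAddCommGroup Y]
    (g : X → Y) (C : Set Y) (x₀ : X) : Prop :=
  CIncreasingAt (fun x => ({-g x} : Set Y)) C x₀

/-- **Ekeland's variational principle** in its strong form, on a complete extended metric space. -/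
theorem LowerSemicontinuous.exists_ekeland {X : Type*} [EMetricSpace X] [CompleteSpace X]
    {f : X → ℝ≥0∞} (hf : LowerSemicontinuous f) {K : ℝ≥0∞} (hK₀ : K ≠ 0) (hK : K ≠ ⊤)
    {x₀ : X} (hx₀ : f x₀ ≠ ⊤) :
    ∃ x, f x + K * edist x₀ x ≤ f x₀ ∧ ∀ z, f z + K * edist x z ≤ f x → z = x := by
  set S : X → Set X := fun x => {z | f z + K * edist x z ≤ f x} with hS
  have hself (x : X) : x ∈ S x := by simp [hS]
  have htrans {x y z : X} (hy : y ∈ S x) (hz : z ∈ S y) : z ∈ S x :=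
    calc f z + K * edist x z ≤ f z + K * (edist x y + edist y z) := by
          gcongr; exact edist_triangle _ _ _
      _ = f z + K * edist y z + K * edist x y := by ring
      _ ≤ f y + K * edist x y := by gcongr; exact hz
      _ ≤ f x := hy
  have hclosed (x : X) : IsClosed (S x) := by
    have hd : Continuous fun z => K * edist x z :=
      (ENNReal.continuous_const_mul hK).comp (by fun_prop)
    exact (hf.add hd.lowerSemicontinuous).isClosed_preimage (f x)
  have hle {x y : X} (hy : y ∈ S x) : f y ≤ f x := le_self_add.trans hy
  have hnext (n : ℕ) (x : X) : ∃ y, y ∈ S x ∧ (f x ≠ ⊤ →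
      f y ≤ (⨅ z ∈ S x, f z) + 1 / 2 ^ n) := by
    by_cases hx : f x = ⊤
    · exact ⟨x, hself x, fun h => (h hx).elim⟩
    have hlt : (⨅ z ∈ S x, f z) < (⨅ z ∈ S x, f z) + 1 / 2 ^ n := by
      refine ENNReal.lt_add_right (ne_top_of_le_ne_top hx (iInf₂_le x (hself x))) ?_
      simp
    simp only [iInf_lt_iff, exists_prop] at hlt
    obtain ⟨y, hy, hlt⟩ := hlt
    exact ⟨y, hy, fun _ => hlt.le⟩
  choose next hmem hnext using hnext
  let u : ℕ → X := fun n => Nat.rec x₀ next n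
  have hu (n : ℕ) : u (n + 1) = next n (u n) := rfl
  have hstep (n : ℕ) : u (n + 1) ∈ S (u n) := hu n ▸ hmem n (u n)
  have hanti {m n : ℕ} (h : m ≤ n) : u n ∈ S (u m) := by
    induction n, h using Nat.le_induction with
    | base => exact hself _
    | succ n _ ih => exact htrans ih (hstep n)
  have hfin (n : ℕ) : f (u n) ≠ ⊤ := ne_top_of_le_ne_top hx₀ (hle (hanti n.zero_le))
  have hdist {n : ℕ} {z : X} (hz : z ∈ S (u (n + 1))) :
      edist (u (n + 1)) z ≤ K⁻¹ / 2 ^ n := by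
    have hzf : f z ≠ ⊤ := ne_top_of_le_ne_top (hfin (n + 1)) (hle hz)
    have h1 : f (u (n + 1)) ≤ f z + 1 / 2 ^ n := by
      rw [hu]
      refine (hnext n (u n) (hfin n)).trans ?_
      gcongr
      exact iInf₂_le z (htrans (hstep n) hz)
    have h2 : K * edist (u (n + 1)) z ≤ 1 / 2 ^ n :=
      (ENNReal.add_le_add_iff_left hzf).1 (le_trans hz h1)
    calc edist (u (n + 1)) z = K⁻¹ * (K * edist (u (n + 1)) z) := by
          rw [← mul_assoc, ENNReal.inv_mul_cancel hK₀ hK, one_mul]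
      _ ≤ K⁻¹ * (1 / 2 ^ n) := by gcongr
      _ = K⁻¹ / 2 ^ n := by rw [one_div, div_eq_mul_inv]
  have hcauchy : CauchySeq fun n => u (n + 1) := by
    refine cauchySeq_of_edist_le_geometric (1 / 2) K⁻¹ (by simp) (by simpa using hK₀) fun n => ?_
    refine (hdist (hstep (n + 1))).trans_eq ?_
    rw [one_div, ← ENNReal.inv_pow, div_eq_mul_inv]
  obtain ⟨x, hx⟩ := cauchySeq_tendsto_of_complete hcauchy
  have hxS (n : ℕ) : x ∈ S (u n) :=
    (hclosed (u n)).mem_of_tendsto hx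
      (eventually_atTop.2 ⟨n, fun m hm => hanti (hm.trans m.le_succ)⟩)
  refine ⟨x, hxS 0, fun z hz => ?_⟩
  have hlim : Tendsto (fun n : ℕ => K⁻¹ / 2 ^ n) atTop (𝓝 0) := by
    have : Tendsto (fun n : ℕ => K⁻¹ * (1 / 2) ^ n) atTop (𝓝 (K⁻¹ * 0)) :=
      ENNReal.Tendsto.const_mul (ENNReal.tendsto_pow_atTop_nhds_zero_of_lt_one (by simp))
        (Or.inr (by simpa using hK₀))
    simpa [div_eq_mul_inv, ENNReal.inv_pow] using this
  have hz' : Tendsto (fun n => u (n + 1)) atTop (𝓝 z) :=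
    tendsto_iff_edist_tendsto_0.2 <| tendsto_of_tendsto_of_tendsto_of_le_of_le
      tendsto_const_nhds hlim (fun _ => zero_le) fun n => hdist (htrans (hxS (n + 1)) hz)
  exact tendsto_nhds_unique hz' hx

section Excess

variable {Y : Type*}

theorem excess_le_iff [PseudoEMetricSpace Y] {A B : Set Y} {M : ℝ≥0∞} :
    excess A B ≤ M ↔ ∀ a ∈ A, infEDist a B ≤ M :=
  iSup₂_le_iff

theorem infEDist_le_excess [PseudoEMetricSpace Y] {A B : Set Y} {a : Y} (ha : a ∈ A) :
    infEDist a B ≤ excess A B :=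
  excess_le_iff.1 le_rfl a ha

theorem excess_eq_zero_iff [PseudoEMetricSpace Y] {A B : Set Y} (hB : IsClosed B) :
    excess A B = 0 ↔ A ⊆ B := by
  rw [← nonpos_iff_eq_zero, excess_le_iff]
  refine forall₂_congr fun a _ => ?_
  rw [nonpos_iff_eq_zero, ← mem_closure_iff_infEDist_zero, hB.closure_eq]

theorem excess_le_excess_add_hausdorffEDist [PseudoEMetricSpace Y] (A A' B : Set Y) :
    excess A' B ≤ excess A B + hausdorffEDist A A' := by
  refine excess_le_iff.2 fun y hy => ENNReal.le_of_forall_pos_le_add fun ε hε hfin => ?_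
  have hH : hausdorffEDist A A' ≠ ⊤ := fun h => by simp [h] at hfin
  have hlt : infEDist y A < hausdorffEDist A A' + ε := by
    refine lt_of_le_of_lt ?_ (ENNReal.lt_add_right hH (by simpa using hε.ne'))
    rw [hausdorffEDist_comm]
    exact infEDist_le_hausdorffEDist_of_mem hy
  obtain ⟨a, ha, hya⟩ := infEDist_lt_iff.1 hlt
  calc infEDist y B ≤ infEDist a B + edist y a := infEDist_le_infEDist_add_edist
    _ ≤ excess A B + (hausdorffEDist A A' + ε) := by
        gcongr
        exact infEDist_le_excess ha
    _ = _ := by rw [add_assoc]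

theorem LscSV.lowerSemicontinuous_excess {X : Type*} [TopologicalSpace X]
    [PseudoEMetricSpace Y] {G : X → Set Y} (hG : LscSV G) (C : Set Y) :
    LowerSemicontinuous fun x => excess (G x) C := by
  intro x b hb
  simp only [excess, lt_iSup_iff, exists_prop] at hb
  obtain ⟨y, hy, hby⟩ := hb
  have hopen : IsOpen {y : Y | b < infEDist y C} := isOpen_lt continuous_const continuous_infEDist
  filter_upwards [hG x _ hopen ⟨y, hy, hby⟩] with x' ⟨y', hy', hb'⟩
  exact lt_of_lt_of_le hb' (infEDist_le_excess hy')

theorem infEDist_le_of_mem_cthickening_add [SeminormedAddCommGroup Y] {A C : Set Y}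
    (hC : ∀ c ∈ C, ∀ c' ∈ C, c + c' ∈ C) {r : ℝ} {z : Y} (hz : z ∈ cthickening r (A + C)) :
    infEDist z C ≤ excess A C + ENNReal.ofReal r := by
  have hAC : excess (A + C) C ≤ excess A C := by
    refine excess_le_iff.2 ?_
    rintro _ ⟨a, ha, c, hc, rfl⟩
    refine le_trans (le_infEDist.2 fun c' hc' => ?_) (infEDist_le_excess ha)
    calc infEDist (a + c) C ≤ edist (a + c) (c' + c) := infEDist_le_edist_of_mem (hC _ hc' _ hc)
      _ = edist a c' := edist_add_right _ _ _
  refine ENNReal.le_of_forall_pos_le_add fun ε hε _ => ?_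
  have hlt : infEDist z (A + C) < ENNReal.ofReal r + ε :=
    lt_of_le_of_lt hz (ENNReal.lt_add_right ENNReal.ofReal_ne_top (by simpa using hε.ne'))
  obtain ⟨w, hw, hzw⟩ := infEDist_lt_iff.1 hlt
  calc infEDist z C ≤ infEDist w C + edist z w := infEDist_le_infEDist_add_edist
    _ ≤ excess A C + (ENNReal.ofReal r + ε) := by
        gcongr
        exact (infEDist_le_excess hw).trans hAC
    _ = _ := by rw [add_assoc]

/-- Away from a convex set, an enlargement of radius `s` raises the distance to it by `s`. -/
theorem infDist_add_le_of_closedBall [SeminormedAddCommGroup Y] [NormedSpace ℝ Y] {C : Set Y}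
    (hC : Convex ℝ C) (hne : C.Nonempty) {y : Y} (hy : 0 < infDist y C) {s M : ℝ} (hs : 0 ≤ s)
    (hM : ∀ z, dist z y ≤ s → infDist z C ≤ M) : infDist y C + s ≤ M := by
  set d := infDist y C with hd
  have key (D : ℝ) (hD : d < D) : d * (D + s) ≤ M * D := by
    obtain ⟨c, hc, hcD⟩ := (infDist_lt_iff hne).1 hD
    set n := dist y c with hn
    have hdn : d ≤ n := infDist_le_dist_of_mem hc
    have hn0 : 0 < n := hy.trans_le hdn
    set z := y + (s / n) • (y - c) with hz
    have hzy : dist z y ≤ s := by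
      rw [hz, dist_eq_norm, add_sub_cancel_left, norm_smul, ← dist_eq_norm, ← hn,
        Real.norm_of_nonneg (by positivity), div_mul_cancel₀ _ hn0.ne']
    have hlow : d * (n + s) / n ≤ infDist z C := by
      refine (le_infDist hne).2 fun {c'} hc' => ?_
      have hmem : (s / (n + s)) • c + (n / (n + s)) • c' ∈ C :=
        hC hc hc' (by positivity) (by positivity) (by field_simp; ring)
      have h1 : d ≤ n / (n + s) * dist z c' := by
        refine (infDist_le_dist_of_mem hmem).trans_eq ?_
        have : y - ((s / (n + s)) • c + (n / (n + s)) • c') = (n / (n + s)) • (z - c') := by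
          rw [hz]
          match_scalars <;> field_simp
        rw [dist_eq_norm, this, norm_smul, Real.norm_of_nonneg (by positivity), ← dist_eq_norm]
      have hns : 0 < n + s := by positivity
      rw [div_mul_eq_mul_div, le_div_iff₀ hns] at h1
      rw [div_le_iff₀ hn0]
      linarith
    have h2 := hlow.trans (hM z hzy)
    rw [div_le_iff₀ hn0] at h2
    have h3 : d ≤ M := hM y (by simpa using hs)
    nlinarith
  have hlim : d * (d + s) ≤ M * d := by
    refine le_of_forall_pos_le_add fun ε hε => ?_
    have := key (d + ε / (|M - d| + 1)) (by simp; positivity)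
    have h4 : ε / (|M - d| + 1) * (|M - d| + 1) = ε := div_mul_cancel₀ _ (by positivity)
    have h5 : 0 ≤ ε / (|M - d| + 1) := by positivity
    nlinarith [le_abs_self (M - d)]
  nlinarith

end Excess

/-- A step along which a `C`-increasing map reduces its excess beyond the convex cone `C`. -/
theorem IsIncBoundAt.exists_excess_add_le {X Y : Type*} [PseudoMetricSpace X]
    [SeminormedAddCommGroup Y] [NormedSpace ℝ Y] {G : X → Set Y} {C : Set Y} {x : X} {a : ℝ}
    (ha : IsIncBoundAt G C x a) (hC : IsClosedConvexCone C) (hx : ¬ G x ⊆ C)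
    (hfin : excess (G x) C ≠ ⊤) :
    ∃ r : ℝ, 0 < r ∧ ∃ u, dist u x ≤ r ∧
      excess (G u) C + ENNReal.ofReal ((a - 1) * r) ≤ excess (G x) C := by
  obtain ⟨hclosed, hconv, h0, hcone⟩ := hC
  obtain ⟨ha1, δ, hδ, hinc⟩ := ha
  have hne : C.Nonempty := ⟨0, h0⟩
  have hadd : ∀ c ∈ C, ∀ c' ∈ C, c + c' ∈ C := fun c hc c' hc' => by
    have := hcone _ (hconv hc hc' (by norm_num : (0 : ℝ) ≤ 1 / 2) (by norm_num : (0 : ℝ) ≤ 1 / 2)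
      (by norm_num)) 2 (by norm_num)
    rw [← smul_add, smul_smul] at this
    simpa using this
  set m := (excess (G x) C).toReal with hm
  have hm' : excess (G x) C = ENNReal.ofReal m := (ENNReal.ofReal_toReal hfin).symm
  have hm0 : 0 < m :=
    ENNReal.toReal_pos (fun h => hx ((excess_eq_zero_iff hclosed).1 h)) hfin
  have hb : 0 < a - 1 := by linarith
  refine ⟨min δ (m / (a - 1)), by positivity, ?_⟩
  set r := min δ (m / (a - 1)) with hr
  have hr0 : 0 < r := by positivity
  obtain ⟨u, hu, hsub⟩ := hinc r hr0 (min_le_left _ _)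
  refine ⟨u, hu, ?_⟩
  have hrm : (a - 1) * r ≤ m := by
    have := min_le_right δ (m / (a - 1))
    rw [← hr, le_div_iff₀ hb] at this
    linarith
  have hpt (y : Y) (hy : y ∈ G u) : infDist y C ≤ m - (a - 1) * r := by
    rcases (infDist_nonneg (x := y) (s := C)).eq_or_lt with h | h
    · rw [← h]; linarith
    have := infDist_add_le_of_closedBall (M := m + r) hconv hne h
      (by positivity : 0 ≤ a * r) fun z hz => by
        have hz' := infEDist_le_of_mem_cthickening_add hadd
          (hsub (mem_cthickening_of_dist_le z y _ _ hy hz))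
        rw [hm', ← ENNReal.ofReal_add hm0.le hr0.le] at hz'
        exact ENNReal.toReal_le_of_le_ofReal (by positivity) hz'
    linarith
  have hG : excess (G u) C ≤ ENNReal.ofReal (m - (a - 1) * r) :=
    excess_le_iff.2 fun y hy => by
      rw [← ENNReal.ofReal_toReal (infEDist_ne_top hne (x := y))]
      exact ENNReal.ofReal_le_ofReal (hpt y hy)
  calc _ ≤ ENNReal.ofReal (m - (a - 1) * r) + ENNReal.ofReal ((a - 1) * r) := by gcongr
    _ = _ := by
      rw [← ENNReal.ofReal_add (by linarith) (by positivity), hm', sub_add_cancel]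

/-- Solvability with an error bound for a single constrained set-valued inclusion: the map is
Lipschitz off the constraint set and increases fast enough on it. -/
theorem exists_mem_subset_of_increasing {X Y : Type*} [MetricSpace X] [CompleteSpace X]
    [SeminormedAddCommGroup Y] [NormedSpace ℝ Y] (hX : MetricallyConvex X)
    {G : X → Set Y} {C : Set Y} {R : Set X} (hC : IsClosedConvexCone C) (hG : LscSV G)
    (hR : Proximinal R) {ℓ κ : ℝ} (hℓ : 0 ≤ ℓ) (hκ : 0 < κ)
    (hlip : ∀ x₁ ∉ R, ∀ x₂ ∉ R,
      hausdorffEDist (G x₁) (G x₂) ≤ ENNReal.ofReal (ℓ * dist x₁ x₂))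
    (hinc : ∀ x ∈ R, ¬ G x ⊆ C → ∃ a, IsIncBoundAt G C x a ∧ 2 * κ + ℓ + 1 ≤ a)
    {x₀ : X} (hx₀ : excess (G x₀) C ≠ ⊤) :
    ∃ x ∈ R, G x ⊆ C ∧ ENNReal.ofReal κ * edist x₀ x ≤
      excess (G x₀) C + ENNReal.ofReal (κ + ℓ) * infEDist x₀ R := by
  obtain ⟨s₀, hs₀, -⟩ := hR x₀
  have hRne : R.Nonempty := ⟨s₀, hs₀⟩
  have hof (x : X) : infEDist x R = ENNReal.ofReal (infDist x R) :=
    (ENNReal.ofReal_toReal (infEDist_ne_top hRne)).symm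
  set c := κ + ℓ with hc
  have hc0 : 0 ≤ c := by positivity
  set f : X → ℝ≥0∞ := fun x => excess (G x) C + ENNReal.ofReal c * infEDist x R with hf
  have hlsc : LowerSemicontinuous f :=
    (hG.lowerSemicontinuous_excess C).add
      ((ENNReal.continuous_const_mul ENNReal.ofReal_ne_top).comp
        continuous_infEDist).lowerSemicontinuous
  have hdesc (x : X) (hx : f x ≠ ⊤) (hxs : ¬ (x ∈ R ∧ G x ⊆ C)) :
      ∃ z ≠ x, f z + ENNReal.ofReal κ * edist x z ≤ f x := by
    have hxe : excess (G x) C ≠ ⊤ := ne_top_of_le_ne_top hx le_self_add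
    by_cases hxR : x ∈ R
    · have hxC : ¬ G x ⊆ C := fun h => hxs ⟨hxR, h⟩
      obtain ⟨a, ha, hka⟩ := hinc x hxR hxC
      obtain ⟨r, hr, u, hur, hle⟩ := ha.exists_excess_add_le hC hxC hxe
      have ha1 : 1 < a := ha.1
      refine ⟨u, ?_, ?_⟩
      · rintro rfl
        have h0 : ENNReal.ofReal ((a - 1) * r) ≠ 0 := by
          simpa using mul_pos (sub_pos.2 ha1) hr
        exact (ENNReal.lt_add_right hxe h0).not_ge hle
      · have hd : infDist u R ≤ r := (infDist_le_dist_of_mem hxR).trans hur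
        have hstep : ENNReal.ofReal c * infEDist u R + ENNReal.ofReal κ * edist x u ≤
            ENNReal.ofReal ((a - 1) * r) := by
          rw [hof, edist_dist, ← ENNReal.ofReal_mul hc0, ← ENNReal.ofReal_mul hκ.le,
            ← ENNReal.ofReal_add (mul_nonneg hc0 infDist_nonneg) (by positivity), dist_comm]
          refine ENNReal.ofReal_le_ofReal ?_
          nlinarith [mul_le_mul_of_nonneg_left hd hc0, mul_le_mul_of_nonneg_left hur hκ.le]
        calc f u + ENNReal.ofReal κ * edist x u
            = excess (G u) C + (ENNReal.ofReal c * infEDist u R +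
                ENNReal.ofReal κ * edist x u) := by rw [hf, add_assoc]
          _ ≤ excess (G u) C + ENNReal.ofReal ((a - 1) * r) := by gcongr
          _ ≤ excess (G x) C := hle
          _ ≤ f x := le_self_add
    · obtain ⟨s, hsR, hs⟩ := hR x
      obtain ⟨z, hzx, hzs, hxz⟩ := hX x s (fun h => hxR (h ▸ hsR))
      have hzR : z ∉ R := fun h => by
        have := infDist_le_dist_of_mem (x := x) h
        have := dist_pos.2 hzs
        linarith
      refine ⟨z, hzx, ?_⟩
      have hzd : infDist z R + dist x z ≤ infDist x R := by
        linarith [infDist_le_dist_of_mem (x := z) hsR]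
      have hstep : ENNReal.ofReal (ℓ * dist x z) + (ENNReal.ofReal c * infEDist z R +
          ENNReal.ofReal κ * edist x z) ≤ ENNReal.ofReal c * infEDist x R := by
        rw [hof, hof, edist_dist, ← ENNReal.ofReal_mul hc0, ← ENNReal.ofReal_mul hκ.le,
          ← ENNReal.ofReal_mul hc0,
          ← ENNReal.ofReal_add (mul_nonneg hc0 infDist_nonneg) (by positivity),
          ← ENNReal.ofReal_add (by positivity)
            (add_nonneg (mul_nonneg hc0 infDist_nonneg) (by positivity))]
        refine ENNReal.ofReal_le_ofReal ?_
        nlinarith [mul_le_mul_of_nonneg_left hzd hc0]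
      calc f z + ENNReal.ofReal κ * edist x z
          = excess (G z) C + (ENNReal.ofReal c * infEDist z R +
              ENNReal.ofReal κ * edist x z) := by rw [hf, add_assoc]
        _ ≤ excess (G x) C + ENNReal.ofReal (ℓ * dist x z) + (ENNReal.ofReal c * infEDist z R +
              ENNReal.ofReal κ * edist x z) := by
            gcongr
            refine (excess_le_excess_add_hausdorffEDist (G x) (G z) C).trans ?_
            gcongr
            exact hlip x hxR z hzR
        _ ≤ f x := by
            rw [add_assoc]
            exact add_le_add_right hstep _
  have hfx₀ : f x₀ ≠ ⊤ := by
    simp only [hf, hof]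
    finiteness
  obtain ⟨x, hx, hmin⟩ := hlsc.exists_ekeland (K := ENNReal.ofReal κ) (by simpa using hκ)
    ENNReal.ofReal_ne_top hfx₀
  by_contra! hcon
  have hsol : ¬ (x ∈ R ∧ G x ⊆ C) := fun h =>
    (hcon x h.1 h.2).not_ge (le_add_self.trans hx)
  obtain ⟨z, hzx, hz⟩ := hdesc x (ne_top_of_le_ne_top hfx₀ (le_self_add.trans hx)) hsol
  exact hzx (hmin z hz)

theorem exists_isIncBoundAt_of_lt_alphaTilde {P X Y : Type*} [PseudoMetricSpace X]
    [SeminormedAddCommGroup Y] {F : P → X → Set Y} {Cm : P → Set Y} {R : P → Set X} {b : ℝ}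
    (hb : ENNReal.ofReal b < alphaTilde F Cm R) {p : P} {x : X} (hx : x ∈ R p)
    (hxC : ¬ F p x ⊆ Cm p) : ∃ a, IsIncBoundAt (F p) (Cm p) x a ∧ b ≤ a := by
  have hlt : ENNReal.ofReal b < incBound (F p) (Cm p) x :=
    hb.trans_le (iInf₂_le (p, x) ⟨hxC, hx⟩)
  simp only [incBound, lt_iSup_iff, exists_prop] at hlt
  obtain ⟨a, ha, hba⟩ := hlt
  exact ⟨a, ha, (ENNReal.ofReal_lt_ofReal_iff'.1 hba).1.le⟩

/-- Constrained global solvability of parameterized set-valued inclusions, with the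
associated error bound. -/
theorem stmt13 {P X Y : Type*} [TopologicalSpace P] [MetricSpace X] [CompleteSpace X]
    [NormedAddCommGroup Y] [NormedSpace ℝ Y]
    (hX : MetricallyConvex X)
    (F : P → X → Set Y) (Cm : P → Set Y) (R : P → Set X)
    (hF : ∀ p x, (F p x).Nonempty ∧ IsClosed (F p x))
    (hCm : ∀ p, IsClosedConvexCone (Cm p) ∧ ({0} : Set Y) ≠ Cm p ∧ Cm p ≠ Set.univ)
    (hi : ∀ p : P, ∃ xhat : X, excess (F p xhat) (Cm p) ≠ ⊤)
    (hii : 1 < alphaTilde F Cm R)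
    (ℓ : ℝ) (hℓpos : 0 < ℓ) (hℓlt : ENNReal.ofReal ℓ < alphaTilde F Cm R - 1)
    (hiii : ∀ p : P, LscSV (F p) ∧ ∀ x₁ ∉ R p, ∀ x₂ ∉ R p,
      EMetric.hausdorffEdist (F p x₁) (F p x₂) ≤ ENNReal.ofReal (ℓ * dist x₁ x₂))
    (hiv : ∀ p : P, Proximinal (R p)) :
    (∀ p : P, {x : X | x ∈ R p ∧ F p x ⊆ Cm p}.Nonempty) ∧
    ∀ α : ℝ,
      (alphaTilde F Cm R - ENNReal.ofReal ℓ + 1) / 2 < ENNReal.ofReal α →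
      ENNReal.ofReal α < alphaTilde F Cm R - ENNReal.ofReal ℓ →
      ∀ x₀ : X, ∀ p : P,
        EMetric.infEdist x₀ {x : X | x ∈ R p ∧ F p x ⊆ Cm p} ≤
          (excess (F p x₀) (Cm p) +
              (alphaTilde F Cm R - ENNReal.ofReal α) * EMetric.infEdist x₀ (R p)) /
            (alphaTilde F Cm R - ENNReal.ofReal α - ENNReal.ofReal ℓ) := by
  have hsolve (κ : ℝ) (hκ : 0 < κ) (hlt : ENNReal.ofReal (2 * κ + ℓ + 1) < alphaTilde F Cm R)
      (p : P) (x₀ : X) (hx₀ : excess (F p x₀) (Cm p) ≠ ⊤) :=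
    exists_mem_subset_of_increasing hX (hCm p).1 (hiii p).1 (hiv p) hℓpos.le hκ (hiii p).2
      (fun x hx hxC => exists_isIncBoundAt_of_lt_alphaTilde hlt hx hxC) hx₀
  have hA : ENNReal.ofReal (ℓ + 1) < alphaTilde F Cm R := by
    rw [ENNReal.ofReal_add hℓpos.le zero_le_one, ENNReal.ofReal_one]
    exact lt_tsub_iff_right.1 hℓlt
  constructor
  · intro p
    obtain ⟨b, hb, hbA⟩ := ENNReal.lt_iff_exists_nnreal_btwn.1 hA
    have hb' : ℓ + 1 < b := by
      rwa [← ENNReal.ofReal_coe_nnreal, ENNReal.ofReal_lt_ofReal_iff_of_nonneg (by positivity)]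
        at hb
    obtain ⟨xhat, hxhat⟩ := hi p
    obtain ⟨x, hxR, hxC, -⟩ := hsolve ((b - ℓ - 1) / 2) (by linarith)
      (by rw [show 2 * ((b - ℓ - 1) / 2) + ℓ + 1 = (b : ℝ) by ring]; simpa using hbA) p xhat hxhat
    exact ⟨x, hxR, hxC⟩
  · intro α hα₁ hα₂ x₀ p
    have hfin : alphaTilde F Cm R ≠ ⊤ := by
      intro h
      simp [h, ENNReal.top_div] at hα₁
    obtain ⟨A, hA0, hAeq⟩ : ∃ A : ℝ, 0 ≤ A ∧ alphaTilde F Cm R = ENNReal.ofReal A :=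
      ⟨_, ENNReal.toReal_nonneg, (ENNReal.ofReal_toReal hfin).symm⟩
    rw [hAeq] at hsolve hA hα₁ hα₂ ⊢
    have hℓA : ℓ + 1 < A := (ENNReal.ofReal_lt_ofReal_iff'.1 hA).1
    have hα₁' : (A - ℓ + 1) / 2 < α := by
      rw [← ENNReal.ofReal_sub _ hℓpos.le, ← ENNReal.ofReal_one,
        ← ENNReal.ofReal_add (by linarith) zero_le_one,
        show (2 : ℝ≥0∞) = ENNReal.ofReal 2 by simp,
        ← ENNReal.ofReal_div_of_pos two_pos] at hα₁
      exact (ENNReal.ofReal_lt_ofReal_iff'.1 hα₁).1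
    have hα₂' : α < A - ℓ := by
      rw [← ENNReal.ofReal_sub _ hℓpos.le] at hα₂
      exact (ENNReal.ofReal_lt_ofReal_iff'.1 hα₂).1
    have hα0 : 0 ≤ α := by linarith
    rw [← ENNReal.ofReal_sub _ hα0, ← ENNReal.ofReal_sub _ hℓpos.le]
    have hκ : 0 < A - α - ℓ := by linarith
    have hκ' : ENNReal.ofReal (A - α - ℓ) ≠ 0 := (ENNReal.ofReal_pos.2 hκ).ne'
    rw [ENNReal.le_div_iff_mul_le (Or.inl hκ') (Or.inl ENNReal.ofReal_ne_top), mul_comm]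
    by_cases hx₀ : excess (F p x₀) (Cm p) = ⊤
    · simp [hx₀]
    obtain ⟨x, hxR, hxC, hx⟩ := hsolve (A - α - ℓ) hκ
      ((ENNReal.ofReal_lt_ofReal_iff (by linarith)).2 (by linarith)) p x₀ hx₀
    rw [sub_add_cancel] at hx
    refine le_trans ?_ hx
    gcongr
    exact infEDist_le_edist_of_mem ⟨hxR, hxC⟩
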